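/- For a partition λ with |λ| ≤ n, the number of k-divisible type B noncrossing partitions of {±1,...,±kn} with type λ equals (kn)! / (m_λ · (kn − ℓ(λ))!). -/

import Mathlib

/-- A set partition of `{0, …, n-1}` is noncrossing if there is no quadruple
`a < b < c < d` with `a, c` in one block and `b, d` in a different block. -/
def IsNoncrossing {n : ℕ} (P : Finpartition (Finset.univ : Finset (Fin n))) : Prop :=
  ¬ ∃ (a b c d : Fin n) (B B' : Finset (Fin n)), a < b ∧ b < c ∧ c < d ∧
      B ∈ P.parts ∧ B' ∈ P.parts ∧ B ≠ B' ∧ a ∈ B ∧ c ∈ B ∧ b ∈ B' ∧ d ∈ B'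

/-- The antipodal map on `{0, …, 2n-1}` (representing `1, …, n, -1, …, -n` clockwise),
sending each symbol to its negative. -/
def antipode (n : ℕ) (x : Fin (2 * n)) : Fin (2 * n) :=
  ⟨(x.1 + n) % (2 * n), Nat.mod_lt _ (Nat.lt_of_le_of_lt (Nat.zero_le _) x.isLt)⟩

/-- `m_λ = ∏_i m_i(λ)!`, the product of factorials of multiplicities of parts. -/
def mfac (lam : Multiset ℕ) : ℕ := lam.toFinset.prod fun i => (lam.count i).factorial

theorem exists_perm_comp_of_map_univ_eq {α ι : Type*} [Fintype α] {f w : α → ι}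
    (h : Finset.univ.val.map w = Finset.univ.val.map f) : ∃ σ : Equiv.Perm α, f ∘ σ = w := by
  classical
  have hc : ∀ i, Nonempty ({a // w a = i} ≃ {a // f a = i}) := fun i => by
    have := congrArg (Multiset.count i) h
    rw [Multiset.count_map, Multiset.count_map] at this
    refine ⟨Fintype.equivOfCardEq ?_⟩
    rw [Fintype.card_subtype, Fintype.card_subtype]
    simpa [Finset.card, Finset.filter, eq_comm] using this
  let e := fun i => (hc i).some
  refine ⟨(Equiv.sigmaFiberEquiv w).symm.trans
    ((Equiv.sigmaCongrRight e).trans (Equiv.sigmaFiberEquiv f)), ?_⟩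
  funext a
  exact (e (w a) ⟨a, rfl⟩).2

theorem ncard_map_univ_eq {α ι : Type*} [Fintype α] [DecidableEq α] [DecidableEq ι] (f : α → ι) :
    {w : α → ι | Finset.univ.val.map w = Finset.univ.val.map f}.ncard *
      ∏ i ∈ (Finset.univ.val.map f).toFinset, ((Finset.univ.val.map f).count i).factorial =
      (Fintype.card α).factorial := by
  classical
  have hset : {w : α → ι | Finset.univ.val.map w = Finset.univ.val.map f} =
      (Finset.univ.image fun g : Equiv.Perm α => f ∘ g : Finset (α → ι)) := by
    ext w
    simp only [Set.mem_ofPred_eq, Finset.coe_image, Finset.coe_univ, Set.image_univ, Set.mem_range]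
    refine ⟨exists_perm_comp_of_map_univ_eq, ?_⟩
    rintro ⟨σ, rfl⟩
    rw [← Multiset.map_map, ← Equiv.coe_toEmbedding, ← Finset.map_val, Finset.map_univ_equiv]
  rw [hset, Set.ncard_coe_finset, ← Fintype.card_perm, ← Finset.card_univ (α := Equiv.Perm α),
    Finset.card_eq_sum_card_image (fun g : Equiv.Perm α => f ∘ g), Finset.sum_const_nat]
  intro w hw
  obtain ⟨g₀, -, rfl⟩ := Finset.mem_image.1 hw
  have h1 : (Finset.univ.filter fun g : Equiv.Perm α => f ∘ g = f ∘ g₀).card =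
      Fintype.card {g : Equiv.Perm α // f ∘ g = f} := by
    rw [Fintype.card_subtype]
    refine Finset.card_bij (fun g _ => g * g₀⁻¹) ?_ ?_ ?_
    · intro g hg
      simp only [Finset.mem_filter, Finset.mem_univ, true_and] at hg ⊢
      rw [Equiv.Perm.coe_mul, ← Function.comp_assoc, hg, Function.comp_assoc, ← Equiv.Perm.coe_mul]
      simp
    · intro a _ b _ h
      simpa using h
    · intro g hg
      refine ⟨g * g₀, ?_, by simp⟩
      simp only [Finset.mem_filter, Finset.mem_univ, true_and] at hg ⊢
      rw [Equiv.Perm.coe_mul, ← Function.comp_assoc, hg]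
  rw [h1, DomMulAct.stabilizer_card']
  have h2 : (Finset.univ.val.map f).toFinset = Finset.univ.image f := rfl
  rw [h2]
  refine Finset.prod_congr rfl fun i _ => ?_
  congr 1
  rw [Multiset.count_map, Fintype.card_subtype]
  simp [Finset.card, Finset.filter, eq_comm]

/-- The multiset of nonzero values of a function. -/
def nonzeroValues {α : Type*} [Fintype α] (w : α → ℕ) : Multiset ℕ :=
  (Finset.univ.val.map w).filter (· ≠ 0)

theorem ncard_nonzeroValues_eq (N : ℕ) (mu : Multiset ℕ) (hpos : ∀ i ∈ mu, 0 < i)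
    (hcard : Multiset.card mu ≤ N) :
    {w : Fin N → ℕ | nonzeroValues w = mu}.ncard =
      N.factorial / (mfac mu * (N - Multiset.card mu).factorial) := by
  classical
  have hmu : mu.filter (· ≠ 0) = mu := Multiset.filter_eq_self.2 fun i hi => (hpos i hi).ne'
  set M : Multiset ℕ := Multiset.replicate (N - Multiset.card mu) 0 + mu with hM
  have hMc : Multiset.card M = N := by simp [hM]; omega
  obtain ⟨l, hl⟩ : ∃ l : List ℕ, (l : Multiset ℕ) = M := Quotient.exists_rep M
  have hlN : l.length = N := by rw [← hMc, ← hl]; simp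
  subst hlN
  have hf : Finset.univ.val.map l.get = M := by
    rw [← hl]; simp [Finset.univ, Fintype.elems]
  have hset : {w : Fin l.length → ℕ | nonzeroValues w = mu} =
      {w | Finset.univ.val.map w = Finset.univ.val.map l.get} := by
    ext w
    simp only [Set.mem_ofPred_eq, nonzeroValues, hf]
    constructor
    · intro h
      rw [hM, ← Multiset.filter_add_not (· = 0) (Finset.univ.val.map w)]
      refine congrArg₂ (· + ·) ?_ h
      have hc := congrArg Multiset.card (Multiset.filter_add_not (· = 0) (Finset.univ.val.map w))
      rw [Multiset.card_add, Multiset.card_map, Finset.card_val, Finset.card_univ,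
        Fintype.card_fin] at hc
      refine Multiset.eq_replicate.2 ⟨?_, fun b hb => (Multiset.mem_filter.1 hb).2⟩
      rw [← h]
      exact Nat.eq_sub_of_add_eq hc
    · intro h
      rw [h, hM, Multiset.filter_add, hmu]
      simp [Multiset.filter_eq_nil, Multiset.mem_replicate]
  have key := ncard_map_univ_eq l.get
  have hprod : ∏ i ∈ M.toFinset, (M.count i).factorial =
      mfac mu * (l.length - Multiset.card mu).factorial := by
    have h0 : mu.count 0 = 0 := Multiset.count_eq_zero.2 fun h => (hpos 0 h).ne' rfl
    have : M.toFinset ⊆ insert 0 mu.toFinset := by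
      intro i
      simp only [hM, Multiset.mem_toFinset, Multiset.mem_add, Multiset.mem_replicate,
        Finset.mem_insert]
      tauto
    rw [Finset.prod_subset this, Finset.prod_insert, mul_comm, mfac]
    · congr 1
      · refine Finset.prod_congr rfl fun i hi => ?_
        have : 0 ≠ i := (hpos i (Multiset.mem_toFinset.1 hi)).ne
        simp [hM, Multiset.count_replicate, this]
      · simp [hM, h0]
    · simpa [← Multiset.count_eq_zero] using h0
    · intro i _ hi
      rw [Multiset.mem_toFinset] at hi
      simp [Multiset.count_eq_zero.2 hi]
  rw [hset]
  rw [hf, hprod, Fintype.card_fin] at key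
  rw [hf]
  refine (Nat.div_eq_of_eq_mul_left ?_ key.symm).symm
  exact Nat.mul_pos (Finset.prod_pos fun i _ => Nat.factorial_pos _) (Nat.factorial_pos _)

/-- The height before position `x` of the lattice path on `ℤ` whose step at `t` is `W t - 1`. -/
noncomputable def height (W : ℤ → ℕ) (x : ℤ) : ℤ :=
  ∑ t ∈ Finset.Ico 0 x, ((W t : ℤ) - 1) - ∑ t ∈ Finset.Ico x 0, ((W t : ℤ) - 1)

theorem height_add_one (W : ℤ → ℕ) (x : ℤ) : height W (x + 1) = height W x + W x - 1 := by
  unfold height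
  rcases le_or_gt 0 x with hx | hx
  · have h : Finset.Ico 0 (x + 1) = insert x (Finset.Ico 0 x) := by
      ext t; simp only [Finset.mem_Ico, Finset.mem_insert]; omega
    rw [h, Finset.sum_insert (by simp), Finset.Ico_eq_empty (a := x) (by omega),
      Finset.Ico_eq_empty (a := x + 1) (by omega)]
    ring
  · have h : Finset.Ico x 0 = insert x (Finset.Ico (x + 1) 0) := by
      ext t; simp only [Finset.mem_Ico, Finset.mem_insert]; omega
    rw [h, Finset.sum_insert (by simp), Finset.Ico_eq_empty (b := x) (by omega),
      Finset.Ico_eq_empty (b := x + 1) (by omega)]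
    ring

theorem height_eq_add_sum (W : ℤ → ℕ) {a b : ℤ} (hab : a ≤ b) :
    height W b = height W a + ∑ t ∈ Finset.Ico a b, (W t : ℤ) - (b - a) := by
  induction b, hab using Int.leInduction with
  | base => simp
  | succ b hab ih =>
    have h : Finset.Ico a (b + 1) = insert b (Finset.Ico a b) := by
      ext t; simp only [Finset.mem_Ico, Finset.mem_insert]; omega
    rw [height_add_one, ih, h, Finset.sum_insert (by simp)]
    ring

theorem height_add_period {W : ℤ → ℕ} {N : ℤ} (hW : ∀ x, W (x + N) = W x) (x : ℤ) :
    height W (x + N) - height W x = height W N - height W 0 := by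
  induction x using Int.induction_on with
  | zero => simp
  | succ i ih =>
    rw [show (i : ℤ) + 1 + N = i + N + 1 by ring, height_add_one, height_add_one, hW]
    linarith
  | pred i ih =>
    have h1 := height_add_one W (-(i : ℤ) - 1 + N)
    have h2 := height_add_one W (-(i : ℤ) - 1)
    rw [hW] at h1
    rw [show -(i : ℤ) - 1 + N + 1 = -i + N by ring] at h1
    rw [show -(i : ℤ) - 1 + 1 = -i by ring] at h2
    linarith

/-- Reading the path `height W` as a stack machine in which position `t` opens a block of size
`W t`, position `x` belongs to the block opened at `j`. -/
def Owns (W : ℤ → ℕ) (j x : ℤ) : Prop :=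
  j ≤ x ∧ height W j ≤ height W (x + 1) ∧ ∀ t, j < t → t ≤ x → height W (x + 1) < height W t

theorem Owns.unique {W : ℤ → ℕ} {i j x : ℤ} (hi : Owns W i x) (hj : Owns W j x) : i = j := by
  obtain ⟨h1, h2, h3⟩ := hi
  obtain ⟨h4, h5, h6⟩ := hj
  rcases lt_trichotomy i j with h | h | h
  · linarith [h3 j h h4]
  · exact h
  · linarith [h6 i h h1]

theorem owns_self {W : ℤ → ℕ} {j : ℤ} : Owns W j j ↔ 0 < W j := by
  unfold Owns
  rw [height_add_one]
  constructor
  · rintro ⟨-, h, -⟩; omega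
  · intro h; exact ⟨le_rfl, by omega, fun t h1 h2 => by omega⟩

theorem Owns.pos {W : ℤ → ℕ} {j x : ℤ} (h : Owns W j x) : 0 < W j := by
  obtain ⟨h1, h2, h3⟩ := h
  rcases h1.eq_or_lt with rfl | h1
  · exact owns_self.1 ⟨le_rfl, h2, h3⟩
  · have := h3 (j + 1) (by omega) (by omega)
    rw [height_add_one W j] at this
    omega

/-- Blocks opened inside the gap between two elements of a block are confined to that gap. -/
theorem Owns.nested {W : ℤ → ℕ} {j x y z : ℤ} (hx : Owns W j x) (hz : Owns W j z) (hxy : x < y)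
    (hyz : y < z) :
    ∃ i, Owns W i y ∧ (i = j ∨ x < i ∧ ∀ t, Owns W i t → t < z) := by
  classical
  obtain ⟨x1, x2, x3⟩ := hx
  obtain ⟨z1, z2, z3⟩ := hz
  have hzy := z3 (y + 1) (by omega) (by omega)
  obtain ⟨i, ⟨hi1, hi2⟩, hi3⟩ := Int.exists_greatest_of_bdd
    (P := fun i => i ≤ y ∧ height W i ≤ height W (y + 1)) ⟨y, fun _ h => h.1⟩
    ⟨j, by omega, by omega⟩
  have hown : Owns W i y := ⟨hi1, hi2, fun t h1 h2 => by
    by_contra! h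
    have := hi3 t ⟨h2, h⟩
    omega⟩
  refine ⟨i, hown, ?_⟩
  have hji : j ≤ i := hi3 j ⟨by omega, by omega⟩
  rcases hji.eq_or_lt with h | hji
  · exact Or.inl h.symm
  right
  have hxi : x < i := by
    by_contra! h
    have h4 := x3 i hji h
    have := hi3 (x + 1) ⟨by omega, by omega⟩
    omega
  refine ⟨hxi, fun t ht => ?_⟩
  by_contra! h
  obtain ⟨t1, t2, t3⟩ := ht
  have h4 := z3 i hji (by omega)
  rcases h.eq_or_lt with rfl | h
  · omega
  · have := t3 (z + 1) (by omega) (by omega)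
    omega

section Periodic

variable {W : ℤ → ℕ} {N : ℤ}

theorem Owns.add_period (hW : ∀ x, W (x + N) = W x) {j x : ℤ} (h : Owns W j x) :
    Owns W (j + N) (x + N) := by
  obtain ⟨h1, h2, h3⟩ := h
  have hp := height_add_period hW
  refine ⟨by omega, ?_, fun t ht1 ht2 => ?_⟩
  · have e1 := hp j
    have e2 := hp (x + 1)
    rw [show x + N + 1 = x + 1 + N by ring]
    omega
  · have e1 := hp (t - N)
    have e2 := hp (x + 1)
    have e3 := h3 (t - N) (by omega) (by omega)
    rw [sub_add_cancel] at e1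
    rw [show x + N + 1 = x + 1 + N by ring]
    omega

theorem Owns.sub_period (hW : ∀ x, W (x + N) = W x) {j x : ℤ} (h : Owns W j x) :
    Owns W (j - N) (x - N) := by
  have hW' : ∀ x, W (x + -N) = W x := fun x => by
    rw [← hW (x + -N), neg_add_cancel_right]
  exact h.add_period hW'

theorem Owns.add_mul_period (hW : ∀ x, W (x + N) = W x) {j x : ℤ} (h : Owns W j x) (m : ℤ) :
    Owns W (j + m * N) (x + m * N) := by
  have hW' : ∀ m x : ℤ, W (x + m * N) = W x := fun m => by
    induction m using Int.induction_on with
    | zero => simp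
    | succ i ih => intro x; rw [add_mul, one_mul, ← add_assoc, hW, ih]
    | pred i ih => intro x; rw [← hW, ← ih x]; congr 1; ring
  exact h.add_period (hW' m)

theorem Owns.lt_add_period (hN : 0 < N) (hW : ∀ x, W (x + N) = W x)
    (hle : height W N ≤ height W 0) {j x : ℤ} (h : Owns W j x) : x < j + N := by
  obtain ⟨h1, h2, h3⟩ := h
  by_contra! hx
  have := h3 (j + N) (by omega) hx
  have := height_add_period hW j
  omega

/-- The owners of `x`, modulo `2N`. -/
def ownerClass (W : ℤ → ℕ) (N : ℤ) (x : ℤ) : Set ℤ :=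
  {j | ∃ i, Owns W i x ∧ 2 * N ∣ j - i}

theorem ownerClass_eq_iff_of_owns {i j x y : ℤ} (hx : Owns W i x) (hy : Owns W j y) :
    ownerClass W N x = ownerClass W N y ↔ 2 * N ∣ i - j := by
  constructor
  · intro h
    have : i ∈ ownerClass W N x := ⟨i, hx, by simp⟩
    rw [h] at this
    obtain ⟨k, hk, hd⟩ := this
    rwa [hk.unique hy] at hd
  · intro h
    ext l
    constructor
    · rintro ⟨k, hk, hd⟩
      refine ⟨j, hy, ?_⟩
      rw [hk.unique hx] at hd
      simpa using dvd_add hd h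
    · rintro ⟨k, hk, hd⟩
      refine ⟨i, hx, ?_⟩
      rw [hk.unique hy] at hd
      simpa using dvd_sub hd h

theorem ownerClass_nonempty {x : ℤ} : (ownerClass W N x).Nonempty ↔ ∃ j, Owns W j x :=
  ⟨fun ⟨_, i, h, _⟩ => ⟨i, h⟩, fun ⟨j, h⟩ => ⟨j, j, h, by simp⟩⟩

theorem ownerClass_eq_iff {x y : ℤ} : ownerClass W N x = ownerClass W N y ↔
    (∃ i j, Owns W i x ∧ Owns W j y ∧ 2 * N ∣ i - j) ∨
      (¬ ∃ i, Owns W i x) ∧ ¬ ∃ j, Owns W j y := by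
  rw [← ownerClass_nonempty (N := N), ← ownerClass_nonempty (N := N),
    Set.not_nonempty_iff_eq_empty, Set.not_nonempty_iff_eq_empty]
  constructor
  · intro h
    rcases Set.eq_empty_or_nonempty (ownerClass W N x) with hx | hx
    · exact Or.inr ⟨hx, h ▸ hx⟩
    · obtain ⟨i, hi⟩ := ownerClass_nonempty.1 hx
      obtain ⟨j, hj⟩ := ownerClass_nonempty.1 (h ▸ hx)
      exact Or.inl ⟨i, j, hi, hj, (ownerClass_eq_iff_of_owns hi hj).1 h⟩
  · rintro (⟨i, j, hi, hj, h⟩ | ⟨hx, hy⟩)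
    · exact (ownerClass_eq_iff_of_owns hi hj).2 h
    · rw [hx, hy]

theorem exists_owns_of_ownerClass_eq (hW : ∀ x, W (x + N) = W x) {j x y : ℤ} (hx : Owns W j x)
    (h : ownerClass W N x = ownerClass W N y) : ∃ m, Owns W j (y + 2 * m * N) := by
  have : ∃ i, Owns W i y := by
    rw [← ownerClass_nonempty (N := N), ← h]
    exact ownerClass_nonempty.2 ⟨j, hx⟩
  obtain ⟨i, hi⟩ := this
  obtain ⟨m, hm⟩ := (ownerClass_eq_iff_of_owns hx hi).1 h
  refine ⟨m, ?_⟩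
  have := hi.add_mul_period hW (2 * m)
  rwa [show i + 2 * m * N = j by linarith] at this

end Periodic

/-- A `2N`-periodic coloring of `ℤ` whose color classes form an antipodally symmetric noncrossing
partition of `ℤ / 2N`. -/
structure IsAntipodalNoncrossing {α : Type*} (N : ℤ) (c : ℤ → α) : Prop where
  periodic : ∀ x, c (x + 2 * N) = c x
  shift : ∀ x y, c x = c y → c (x + N) = c (y + N)
  noncrossing : ∀ x y z t, x < y → y < z → z < t → t < x + 2 * N → c x = c z → c y = c t → c x = c y

/-- The position `y` is the first element of its block, which is not antipodal. -/
def IsFirst {α : Type*} (N : ℤ) (c : ℤ → α) (y : ℤ) : Prop :=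
  ∀ t, y - N ≤ t → t < y → c t ≠ c y

/-- The lift to `[y, y + N)` of the block of `y`. -/
noncomputable def arcBlock {α : Type*} (N : ℤ) (c : ℤ → α) (y : ℤ) : Finset ℤ :=
  open Classical in (Finset.Ico y (y + N)).filter fun x => c y = c x

open Classical in
/-- The size of the block opened at `y`, or `0` if no block is opened there. -/
noncomputable def openingSize {α : Type*} (N : ℤ) (c : ℤ → α) (y : ℤ) : ℕ :=
  if IsFirst N c y then (arcBlock N c y).card else 0

theorem mem_arcBlock {α : Type*} {N : ℤ} {c : ℤ → α} {x y : ℤ} :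
    x ∈ arcBlock N c y ↔ (y ≤ x ∧ x < y + N) ∧ c y = c x := by
  simp [arcBlock]

section OwnerClass

variable {W : ℤ → ℕ} {N : ℤ}

theorem ownerClass_add_period (hW : ∀ x, W (x + N) = W x) {x y : ℤ}
    (h : ownerClass W N x = ownerClass W N y) :
    ownerClass W N (x + N) = ownerClass W N (y + N) := by
  rw [ownerClass_eq_iff] at h ⊢
  rcases h with ⟨i, j, hi, hj, hd⟩ | ⟨hx, hy⟩
  · exact Or.inl ⟨i + N, j + N, hi.add_period hW, hj.add_period hW, by simpa using hd⟩
  · refine Or.inr ⟨?_, ?_⟩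
    · rintro ⟨i, hi⟩; exact hx ⟨i - N, by simpa using hi.sub_period hW⟩
    · rintro ⟨i, hi⟩; exact hy ⟨i - N, by simpa using hi.sub_period hW⟩

theorem ownerClass_periodic (hW : ∀ x, W (x + N) = W x) (x : ℤ) :
    ownerClass W N (x + 2 * N) = ownerClass W N x := by
  rw [ownerClass_eq_iff]
  by_cases h : ∃ i, Owns W i x
  · obtain ⟨i, hi⟩ := h
    exact Or.inl ⟨i + 2 * N, i, hi.add_mul_period hW 2, hi, by simp⟩
  · refine Or.inr ⟨?_, h⟩
    rintro ⟨i, hi⟩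
    exact h ⟨i - N - N, by
      have := (hi.sub_period hW).sub_period hW
      rwa [show x + 2 * N - N - N = x by ring] at this⟩

theorem ownerClass_noncrossing_of_owns (hN : 0 < N) (hW : ∀ x, W (x + N) = W x)
    {j x y z t : ℤ} (hx : Owns W j x) (hz : Owns W j z) (hxy : x < y) (hyz : y < z)
    (hzt : z < t) (htx : t < x + 2 * N) (h : ownerClass W N y = ownerClass W N t) :
    ownerClass W N x = ownerClass W N y := by
  obtain ⟨i, hi, hij | ⟨hxi, hlt⟩⟩ := hx.nested hz hxy hyz
  · exact (ownerClass_eq_iff_of_owns hx hi).2 (by simp [hij])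
  · exfalso
    obtain ⟨m, hm⟩ := exists_owns_of_ownerClass_eq hW hi h
    have h1 := hlt _ hm
    have h2 := hm.1
    have h3 : m < 0 := by by_contra! h; nlinarith
    have h4 : -1 < m := by by_contra! h; nlinarith
    omega

theorem ownerClass_noncrossing_of_exists_owns (hN : 0 < N) (hW : ∀ x, W (x + N) = W x)
    (hle : height W N ≤ height W 0) {j x y z t : ℤ} (hx : Owns W j x) (hxy : x < y) (hyz : y < z)
    (hzt : z < t) (htx : t < x + 2 * N) (hxz : ownerClass W N x = ownerClass W N z)
    (hyt : ownerClass W N y = ownerClass W N t) :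
    ownerClass W N x = ownerClass W N y := by
  obtain ⟨m, hm⟩ := exists_owns_of_ownerClass_eq hW hx hxz
  have b1 := hm.lt_add_period hN hW hle
  have b2 := hx.lt_add_period hN hW hle
  have b3 := hm.1
  have b4 := hx.1
  have h3 : m < 1 := by by_contra! h; nlinarith
  have h4 : -2 < m := by by_contra! h; nlinarith
  obtain rfl | rfl : m = 0 ∨ m = -1 := by omega
  · exact ownerClass_noncrossing_of_owns hN hW hx (by simpa using hm) hxy hyz hzt htx hyt
  · have hper := ownerClass_periodic hW
    have e1 := hper (z + 2 * -1 * N)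
    have e2 := hper (t + 2 * -1 * N)
    rw [show z + 2 * -1 * N + 2 * N = z by ring] at e1
    rw [show t + 2 * -1 * N + 2 * N = t by ring] at e2
    have := ownerClass_noncrossing_of_owns hN hW hm hx (y := t + 2 * -1 * N) (t := y)
      (by linarith) (by linarith) hxy (by linarith) (by rw [← e2, hyt])
    rw [hxz, hyt, e1, e2, this]

theorem isAntipodalNoncrossing_ownerClass (hN : 0 < N) (hW : ∀ x, W (x + N) = W x)
    (hle : height W N ≤ height W 0) : IsAntipodalNoncrossing N (ownerClass W N) where
  periodic := ownerClass_periodic hW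
  shift _ _ := ownerClass_add_period hW
  noncrossing x y z t hxy hyz hzt htx hxz hyt := by
    by_cases hx : ∃ j, Owns W j x
    · obtain ⟨j, hj⟩ := hx
      exact ownerClass_noncrossing_of_exists_owns hN hW hle hj hxy hyz hzt htx hxz hyt
    by_cases hy : ∃ j, Owns W j y
    · obtain ⟨j, hj⟩ := hy
      have hper := ownerClass_periodic hW x
      have := ownerClass_noncrossing_of_exists_owns hN hW hle hj hyz hzt htx (by linarith) hyt
        (by rw [hper, hxz])
      rw [hxz, this]
    · exact ownerClass_eq_iff.2 (Or.inr ⟨hx, hy⟩)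

theorem isFirst_ownerClass_iff (hN : 0 < N) (hW : ∀ x, W (x + N) = W x)
    (hle : height W N ≤ height W 0) (j : ℤ) : IsFirst N (ownerClass W N) j ↔ 0 < W j := by
  constructor
  · intro h
    by_contra! hj
    by_cases ho : ∃ i, Owns W i j
    · obtain ⟨i, hi⟩ := ho
      have hii := owns_self.2 hi.pos
      have hne : i ≠ j := fun e => by
        have := hi.pos
        rw [e] at this; omega
      have := hi.1
      have := hi.lt_add_period hN hW hle
      exact h i (by omega) (by omega) ((ownerClass_eq_iff_of_owns hii hi).2 (by simp))
    · refine h (j - N) le_rfl (by omega) (ownerClass_eq_iff.2 (Or.inr ⟨?_, ho⟩))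
      rintro ⟨i, hi⟩
      exact ho ⟨i + N, by simpa using hi.add_period hW⟩
  · intro h t ht1 ht2 heq
    obtain ⟨m, hm⟩ := exists_owns_of_ownerClass_eq hW (owns_self.2 h) heq.symm
    have := hm.1
    have := hm.lt_add_period hN hW hle
    have h3 : m < 1 := by by_contra! h; nlinarith
    have h4 : 0 < m := by by_contra! h; nlinarith
    omega

theorem exists_owns_height_eq (hN : 0 < N) (hW : ∀ x, W (x + N) = W x)
    (hle : height W N ≤ height W 0) {j v : ℤ} (h1 : height W j ≤ v) (h2 : v ≤ height W (j + 1)) :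
    ∃ x, Owns W j x ∧ height W (x + 1) = v := by
  have hp := height_add_period hW j
  obtain ⟨x, ⟨hx1, hx2⟩, hx3⟩ := Int.exists_least_of_bdd
    (P := fun x => j ≤ x ∧ height W (x + 1) ≤ v) ⟨j, fun _ h => h.1⟩
    ⟨j + N - 1, by omega, by rw [sub_add_cancel]; omega⟩
  have hgt : ∀ t, j < t → t ≤ x → v < height W t := fun t ht1 ht2 => by
    by_contra! h
    have := hx3 (t - 1) ⟨by omega, by rwa [sub_add_cancel]⟩
    omega
  have heq : height W (x + 1) = v := by
    rcases hx1.eq_or_lt with rfl | hlt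
    · omega
    · have := hgt x hlt le_rfl
      have := height_add_one W x
      omega
  exact ⟨x, ⟨hx1, by omega, fun t h3 h4 => by rw [heq]; exact hgt t h3 h4⟩, heq⟩

theorem openingSize_ownerClass (hN : 0 < N) (hW : ∀ x, W (x + N) = W x)
    (hle : height W N ≤ height W 0) (j : ℤ) : openingSize N (ownerClass W N) j = W j := by
  unfold openingSize
  split_ifs with hf
  · rw [isFirst_ownerClass_iff hN hW hle] at hf
    have hj := owns_self.2 hf
    have hmem : ∀ x, x ∈ arcBlock N (ownerClass W N) j ↔ Owns W j x := fun x => by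
      rw [mem_arcBlock]
      constructor
      · rintro ⟨⟨h1, h2⟩, h3⟩
        obtain ⟨m, hm⟩ := exists_owns_of_ownerClass_eq hW hj h3
        have := hm.1
        have := hm.lt_add_period hN hW hle
        have h3 : m < 1 := by by_contra! h; nlinarith
        have h4 : -1 < m := by by_contra! h; nlinarith
        obtain rfl : m = 0 := by omega
        simpa using hm
      · intro h
        exact ⟨⟨h.1, h.lt_add_period hN hW hle⟩, (ownerClass_eq_iff_of_owns hj h).2 (by simp)⟩
    have hcard : (Finset.Icc (height W j) (height W (j + 1))).card = W j := by
      rw [Int.card_Icc, height_add_one]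
      omega
    rw [← hcard]
    refine Finset.card_bij (fun x _ => height W (x + 1)) ?_ ?_ ?_
    · intro x hx
      rw [hmem] at hx
      obtain ⟨h1, h2, h3⟩ := hx
      rw [Finset.mem_Icc]
      refine ⟨h2, ?_⟩
      rcases h1.eq_or_lt with rfl | h1
      · rfl
      · exact (h3 (j + 1) (by omega) (by omega)).le
    · intro x hx y hy hxy
      rw [hmem] at hx hy
      rcases lt_trichotomy x y with h | h | h
      · have := hy.2.2 (x + 1) (by have := hx.1; omega) (by omega)
        omega
      · exact h
      · have := hx.2.2 (y + 1) (by have := hy.1; omega) (by omega)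
        omega
    · intro v hv
      obtain ⟨h1, h2⟩ := Finset.mem_Icc.1 hv
      obtain ⟨x, hx, hv⟩ := exists_owns_height_eq hN hW hle h1 h2
      exact ⟨x, (hmem x).2 hx, hv⟩
  · rw [isFirst_ownerClass_iff hN hW hle] at hf
    omega

end OwnerClass

namespace IsAntipodalNoncrossing

variable {α : Type*} {N : ℤ} {c : ℤ → α}

theorem exists_isFirst (hc : IsAntipodalNoncrossing N c) (hN : 0 < N) {x : ℤ}
    (hx : c x ≠ c (x + N)) : ∃ y, x - N < y ∧ y ≤ x ∧ c y = c x ∧ IsFirst N c y := by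
  obtain ⟨y, ⟨hy1, hy2⟩, hy3⟩ := Int.exists_least_of_bdd
    (P := fun y => x - N < y ∧ c y = c x) ⟨x - N, fun _ h => h.1.le⟩ ⟨x, by omega, rfl⟩
  have hyx : y ≤ x := hy3 x ⟨by omega, rfl⟩
  refine ⟨y, hy1, hyx, hy2, fun t ht1 ht2 heq => ?_⟩
  have htx : t ≤ x - N := by
    by_contra! h
    have := hy3 t ⟨h, heq.trans hy2⟩
    omega
  have hxN : c (x - N) = c (x + N) := by
    rw [← hc.periodic (x - N)]; congr 1; ring
  have htN : c (t + N) = c (x + N) := hc.shift _ _ (heq.trans hy2)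
  rcases htx.eq_or_lt with rfl | htx
  · exact hx (by rw [← hxN, heq, hy2])
  · have hne : y ≠ t + N := fun e => hx (by rw [← hy2, e, htN])
    have := hc.noncrossing t (x - N) y (t + N) htx hy1 (by omega) (by omega) heq (by rw [hxN, htN])
    exact hx (by rw [← hxN, ← this, heq, hy2])

theorem _root_.IsFirst.ne_add (hc : IsAntipodalNoncrossing N c) (hN : 0 < N) {s : ℤ}
    (hs : IsFirst N c s) : c s ≠ c (s + N) := by
  intro h
  refine hs (s - N) le_rfl (by omega) ?_
  rw [h, ← hc.periodic (s - N)]; congr 1; ring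

theorem _root_.IsFirst.disjoint {s s' : ℤ} (hs : IsFirst N c s) (hs' : IsFirst N c s')
    (hne : s ≠ s') : Disjoint (arcBlock N c s) (arcBlock N c s') := by
  rw [Finset.disjoint_left]
  intro y hy hy'
  rw [mem_arcBlock] at hy hy'
  rcases lt_or_gt_of_ne hne with h | h
  · exact hs' s (by omega) h (hy.2.trans hy'.2.symm)
  · exact hs s' (by omega) h (hy'.2.trans hy.2.symm)

theorem sum_openingSize [DecidablePred (IsFirst N c)] (a b : ℤ) :
    ∑ t ∈ Finset.Ico a b, openingSize N c t =
      (((Finset.Ico a b).filter (IsFirst N c)).biUnion (arcBlock N c)).card := by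
  rw [Finset.card_biUnion, Finset.sum_filter]
  · refine Finset.sum_congr rfl fun t _ => ?_
    unfold openingSize
    congr
  · intro s hs s' hs' hne
    exact (Finset.mem_filter.1 hs).2.disjoint (Finset.mem_filter.1 hs').2 hne

theorem height_lt_of_confined {x t : ℤ} (htx : t ≤ x)
    (h : ∀ s, t ≤ s → s ≤ x → IsFirst N c s → ∀ y ∈ arcBlock N c s, y < x) :
    height (openingSize N c) (x + 1) < height (openingSize N c) t := by
  classical
  rw [height_eq_add_sum _ (show t ≤ x + 1 by omega), ← Nat.cast_sum, sum_openingSize]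
  have hsub : ((Finset.Ico t (x + 1)).filter (IsFirst N c)).biUnion (arcBlock N c) ⊆
      Finset.Ico t x := by
    intro y hy
    obtain ⟨s, hs, hy⟩ := Finset.mem_biUnion.1 hy
    obtain ⟨hs, hf⟩ := Finset.mem_filter.1 hs
    rw [Finset.mem_Ico] at hs ⊢
    exact ⟨hs.1.trans (mem_arcBlock.1 hy).1.1, h s hs.1 (by omega) hf y hy⟩
  have := Finset.card_le_card hsub
  rw [Int.card_Ico] at this
  omega

theorem height_le_of_covered {x j : ℤ} (hjx : j ≤ x)
    (h : ∀ y, j ≤ y → y ≤ x → ∃ s, j ≤ s ∧ s ≤ y ∧ IsFirst N c s ∧ y ∈ arcBlock N c s) :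
    height (openingSize N c) j ≤ height (openingSize N c) (x + 1) := by
  classical
  rw [height_eq_add_sum _ (show j ≤ x + 1 by omega), ← Nat.cast_sum, sum_openingSize]
  have hsub : Finset.Ico j (x + 1) ⊆
      ((Finset.Ico j (x + 1)).filter (IsFirst N c)).biUnion (arcBlock N c) := by
    intro y hy
    rw [Finset.mem_Ico] at hy
    obtain ⟨s, hs1, hs2, hf, hm⟩ := h y hy.1 (by omega)
    refine Finset.mem_biUnion.2 ⟨s, Finset.mem_filter.2 ⟨Finset.mem_Ico.2 ⟨hs1, by omega⟩, hf⟩, hm⟩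
  have := Finset.card_le_card hsub
  rw [Int.card_Ico] at this
  omega

theorem owns_of_isFirst (hc : IsAntipodalNoncrossing N c) (hN : 0 < N) {j x : ℤ}
    (hj : IsFirst N c j) (hx : x ∈ arcBlock N c j) : Owns (openingSize N c) j x := by
  obtain ⟨⟨hjx, hxj⟩, hcx⟩ := mem_arcBlock.1 hx
  refine ⟨hjx, height_le_of_covered hjx fun y hy1 hy2 => ?_, fun t ht1 ht2 =>
    height_lt_of_confined ht2 fun s hs1 hs2 hs y hy => ?_⟩
  · have hyN : c y ≠ c (y + N) := by
      intro h
      have hne : c j ≠ c y := fun e => by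
        refine hj (y - N) (by omega) (by omega) ?_
        rw [e, h, ← hc.periodic (y - N)]; congr 1; ring
      have h1 : y ≠ j := by rintro rfl; exact hne rfl
      have h2 : y ≠ x := by rintro rfl; exact hne hcx
      exact hne (hc.noncrossing j y x (y + N) (by omega) (by omega) (by omega) (by omega) hcx h)
    obtain ⟨s, hs1, hs2, hs3, hs⟩ := hc.exists_isFirst hN hyN
    refine ⟨s, ?_, hs2, hs, mem_arcBlock.2 ⟨⟨hs2, by omega⟩, hs3⟩⟩
    by_contra! hsj
    have hne : c s ≠ c j := hj s (by omega) hsj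
    have h1 : y ≠ j := by rintro rfl; exact hne hs3
    have h2 : y ≠ x := by rintro rfl; exact hne (hs3.trans hcx.symm)
    exact hne (hc.noncrossing s j y x hsj (by omega) (by omega) (by omega) hs3 hcx)
  · obtain ⟨⟨hsy, hys⟩, hcy⟩ := mem_arcBlock.1 hy
    have hne : c j ≠ c s := hs j (by omega) (by omega)
    by_contra! hxy
    have h1 : y ≠ x := by rintro rfl; exact hne (hcx.trans hcy.symm)
    have h2 : s ≠ x := by rintro rfl; exact hne hcx
    exact hne (hc.noncrossing j s x y (by omega) (by omega) (by omega) (by omega) hcx hcy)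

theorem not_owns (hc : IsAntipodalNoncrossing N c) (hN : 0 < N) {j x : ℤ}
    (hx : c x = c (x + N)) : ¬ Owns (openingSize N c) j x := by
  rintro ⟨h1, h2, -⟩
  refine absurd (height_lt_of_confined (N := N) (c := c) h1 fun s hs1 hs2 hs y hy => ?_) (by omega)
  obtain ⟨⟨hsy, hys⟩, hcy⟩ := mem_arcBlock.1 hy
  have hne : c s ≠ c x := fun e => by
    have h3 := hc.shift _ _ e
    exact hs.ne_add hc hN (by rw [h3, ← hx, e])
  by_contra! hxy
  have h1 : y ≠ x := by rintro rfl; exact hne hcy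
  have h2 : s ≠ x := by rintro rfl; exact hne rfl
  exact hne (hc.noncrossing s x y (x + N) (by omega) (by omega) (by omega) (by omega) hcy hx)

theorem periodic_mul (hc : IsAntipodalNoncrossing N c) (m x : ℤ) : c (x + 2 * N * m) = c x := by
  induction m using Int.induction_on generalizing x with
  | zero => simp
  | succ i ih => rw [mul_add, mul_one, ← add_assoc, hc.periodic, ih]
  | pred i ih => rw [← hc.periodic, ← ih x]; congr 1; ring

theorem exists_shift (hc : IsAntipodalNoncrossing N c) (hN : 0 < N) (a y : ℤ) :
    ∃ y', a ≤ y' ∧ y' < a + 2 * N ∧ c y' = c y ∧ 2 * N ∣ y - y' := by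
  refine ⟨a + (y - a) % (2 * N), ?_, ?_, ?_, (y - a) / (2 * N), ?_⟩
  · linarith [Int.emod_nonneg (y - a) (show 2 * N ≠ 0 by omega)]
  · linarith [Int.emod_lt_of_pos (y - a) (show 0 < 2 * N by omega)]
  · rw [← hc.periodic_mul ((y - a) / (2 * N))]
    congr 1
    linarith [Int.emod_add_mul_ediv (y - a) (2 * N)]
  · linarith [Int.emod_add_mul_ediv (y - a) (2 * N)]

/-- All antipodal blocks coincide. -/
theorem eq_of_antipodal (hc : IsAntipodalNoncrossing N c) (hN : 0 < N) {x y : ℤ}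
    (hx : c x = c (x + N)) (hy : c y = c (y + N)) : c x = c y := by
  obtain ⟨z, hz1, hz2, hz, -⟩ := hc.exists_shift hN x y
  have hzN : c z = c (z + N) := by rw [hz, hy, hc.shift _ _ hz]
  rw [← hz]
  rcases hz1.eq_or_lt with rfl | hz1
  · rfl
  rcases lt_trichotomy z (x + N) with h | h | h
  · exact hc.noncrossing x z (x + N) (z + N) hz1 h (by omega) (by omega) hx hzN
  · rw [h, hx]
  · have e : c (z - N) = c z := by
      rw [hzN, ← hc.periodic (z - N)]; congr 1; ring
    rw [← e]
    exact hc.noncrossing x (z - N) (x + N) z (by omega) (by omega) h hz2 hx e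

theorem dvd_of_isFirst (hc : IsAntipodalNoncrossing N c) (hN : 0 < N) {i j : ℤ}
    (hi : IsFirst N c i) (hj : IsFirst N c j) (h : c i = c j) : 2 * N ∣ i - j := by
  obtain ⟨k, hk1, hk2, hk, hd⟩ := hc.exists_shift hN (j - N) i
  rcases lt_trichotomy k j with hkj | hkj | hkj
  · exact absurd (hk.trans h) (hj k (by omega) hkj)
  · rwa [hkj] at hd
  · obtain ⟨m, hm⟩ := hd
    have : c (j + 2 * N * m) = c i := by rw [hc.periodic_mul, h]
    exact absurd this (hi _ (by linarith) (by linarith))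

theorem eq_iff_ownerClass_eq (hc : IsAntipodalNoncrossing N c) (hN : 0 < N) {x y : ℤ} :
    c x = c y ↔ ownerClass (openingSize N c) N x = ownerClass (openingSize N c) N y := by
  have key : ∀ {x}, c x ≠ c (x + N) → ∃ j, IsFirst N c j ∧ c j = c x ∧
      Owns (openingSize N c) j x := fun {x} h => by
    obtain ⟨j, h1, h2, h3, h4⟩ := hc.exists_isFirst hN h
    exact ⟨j, h4, h3, hc.owns_of_isFirst hN h4 (mem_arcBlock.2 ⟨⟨h2, by omega⟩, h3⟩)⟩
  rw [ownerClass_eq_iff]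
  by_cases hx : c x = c (x + N) <;> by_cases hy : c y = c (y + N)
  · exact iff_of_true (hc.eq_of_antipodal hN hx hy)
      (Or.inr ⟨fun ⟨_, h⟩ => hc.not_owns hN hx h, fun ⟨_, h⟩ => hc.not_owns hN hy h⟩)
  · obtain ⟨j, -, -, hj⟩ := key hy
    refine iff_of_false (fun h => hy ?_) ?_
    · rw [← h, hx, hc.shift _ _ h]
    · rintro (⟨_, _, h, -⟩ | ⟨-, h⟩)
      · exact hc.not_owns hN hx h
      · exact h ⟨j, hj⟩
  · obtain ⟨j, -, -, hj⟩ := key hx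
    refine iff_of_false (fun h => hx ?_) ?_
    · rw [h, hy, hc.shift _ _ h]
    · rintro (⟨_, _, -, h, -⟩ | ⟨h, -⟩)
      · exact hc.not_owns hN hy h
      · exact h ⟨j, hj⟩
  · obtain ⟨i, hi1, hi2, hi⟩ := key hx
    obtain ⟨j, hj1, hj2, hj⟩ := key hy
    constructor
    · intro h
      exact Or.inl ⟨i, j, hi, hj, hc.dvd_of_isFirst hN hi1 hj1 (by rw [hi2, h, hj2])⟩
    · rintro (⟨i', j', hi', hj', m, hm⟩ | ⟨h, -⟩)
      · rw [hi'.unique hi, hj'.unique hj] at hm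
        rw [← hi2, ← hj2, show i = j + 2 * N * m by linarith, hc.periodic_mul]
      · exact absurd ⟨i, hi⟩ h

theorem shift_iff (hc : IsAntipodalNoncrossing N c) (x y : ℤ) :
    c (x + N) = c (y + N) ↔ c x = c y := by
  refine ⟨fun h => ?_, hc.shift x y⟩
  rw [← hc.periodic x, ← hc.periodic y, two_mul, ← add_assoc, ← add_assoc]
  exact hc.shift _ _ h

theorem isFirst_add (hc : IsAntipodalNoncrossing N c) (y : ℤ) :
    IsFirst N c (y + N) ↔ IsFirst N c y := by
  constructor
  · intro h t h1 h2 e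
    exact h (t + N) (by omega) (by omega) ((hc.shift_iff _ _).2 e)
  · intro h t h1 h2 e
    refine h (t - N) (by omega) (by omega) ((hc.shift_iff _ _).1 ?_)
    rwa [sub_add_cancel]

theorem openingSize_add (hc : IsAntipodalNoncrossing N c) (y : ℤ) :
    openingSize N c (y + N) = openingSize N c y := by
  unfold openingSize
  rw [hc.isFirst_add]
  congr 1
  refine (Finset.card_bij (fun x _ => x + N) ?_ ?_ ?_).symm
  · intro x hx
    rw [mem_arcBlock] at hx ⊢
    exact ⟨by omega, hc.shift _ _ hx.2⟩
  · intro x _ y _ h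
    simpa using h
  · intro x hx
    rw [mem_arcBlock] at hx
    refine ⟨x - N, mem_arcBlock.2 ⟨by omega, ?_⟩, by simp⟩
    rw [← hc.shift_iff, sub_add_cancel, hx.2]

theorem isFirst_of_dvd (hc : IsAntipodalNoncrossing N c) {x y : ℤ} (hx : IsFirst N c x)
    (h : 2 * N ∣ x - y) : IsFirst N c y := by
  obtain ⟨m, hm⟩ := h
  obtain rfl : x = y + 2 * N * m := by linarith
  intro t h1 h2 e
  refine hx (t + 2 * N * m) (by linarith) (by linarith) ?_
  rw [hc.periodic_mul, hc.periodic_mul, e]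

theorem openingSize_ne_zero (hN : 0 < N) (y : ℤ) : openingSize N c y ≠ 0 ↔ IsFirst N c y := by
  unfold openingSize
  split_ifs with h
  · simp only [h, iff_true]
    exact (Finset.card_pos.2 ⟨y, mem_arcBlock.2 ⟨by omega, rfl⟩⟩).ne'
  · simp [h]

end IsAntipodalNoncrossing

theorem openingSize_congr {α β : Type*} {N : ℤ} {c : ℤ → α} {d : ℤ → β}
    (h : ∀ x y, c x = c y ↔ d x = d y) : openingSize N c = openingSize N d := by
  funext y
  have h1 : IsFirst N c y ↔ IsFirst N d y := by simp only [IsFirst, ne_eq, h]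
  have h2 : arcBlock N c y = arcBlock N d y := by ext x; simp only [mem_arcBlock, h]
  unfold openingSize
  rw [h2]
  congr 1
  exact propext h1

section Antipode

theorem antipode_val {N : ℕ} (x : Fin (2 * N)) :
    (antipode N x).1 = if x.1 < N then x.1 + N else x.1 - N := by
  have hx := x.2
  unfold antipode
  split_ifs with h
  · exact Nat.mod_eq_of_lt (by omega)
  · show (x.1 + N) % (2 * N) = _
    rw [show x.1 + N = x.1 - N + 2 * N by omega, Nat.add_mod_right, Nat.mod_eq_of_lt (by omega)]

theorem antipode_antipode {N : ℕ} (x : Fin (2 * N)) : antipode N (antipode N x) = x := by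
  have hx := x.2
  ext
  rw [antipode_val, antipode_val]
  split_ifs <;> omega

end Antipode

theorem nonzeroValues_two_mul {N : ℕ} {W : ℤ → ℕ} (hW : ∀ x, W (x + N) = W x) :
    nonzeroValues (fun i : Fin (2 * N) => W i.1) =
      nonzeroValues (fun i : Fin N => W i.1) + nonzeroValues (fun i : Fin N => W i.1) := by
  have h : ∀ n, (Finset.univ : Finset (Fin n)).val.map (fun i => W i.1) =
      (Multiset.range n).map fun i : ℕ => W i := fun n => by
    rw [← Finset.range_val, ← Nat.Iio_eq_range, ← Fin.map_valEmbedding_univ, Finset.map_val,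
      Multiset.map_map]
    rfl
  unfold nonzeroValues
  rw [h, h, two_mul, Multiset.range_add, Multiset.map_add, Multiset.map_map, Multiset.filter_add]
  congr 3
  funext i
  simp only [Function.comp_apply, Nat.cast_add]
  rw [add_comm, hW]

section Cyclic

variable {N : ℕ} [NeZero N]

/-- Reduction of an integer modulo `2N`. -/
def toCyclic (N : ℕ) [NeZero N] (x : ℤ) : Fin (2 * N) :=
  ⟨(x % (2 * N : ℤ)).toNat, by
    have hN := NeZero.pos N
    have h1 := Int.emod_nonneg x (show (2 * N : ℤ) ≠ 0 by omega)
    have h2 := Int.emod_lt_of_pos x (show (0 : ℤ) < 2 * N by omega)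
    omega⟩

theorem coe_toCyclic (x : ℤ) : ((toCyclic N x).1 : ℤ) = x % (2 * N : ℤ) := by
  have hN := NeZero.pos N
  have h1 := Int.emod_nonneg x (show (2 * N : ℤ) ≠ 0 by omega)
  simp only [toCyclic]
  omega

theorem toCyclic_eq_iff {x y : ℤ} : toCyclic N x = toCyclic N y ↔ 2 * (N : ℤ) ∣ x - y := by
  rw [Fin.ext_iff, ← Nat.cast_inj (R := ℤ), coe_toCyclic, coe_toCyclic,
    Int.emod_eq_emod_iff_emod_sub_eq_zero, Int.dvd_iff_emod_eq_zero]

theorem toCyclic_coe (i : Fin (2 * N)) : toCyclic N (i.1 : ℤ) = i := by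
  have := i.2
  rw [Fin.ext_iff, ← Nat.cast_inj (R := ℤ), coe_toCyclic]
  exact Int.emod_eq_of_lt (by omega) (by omega)

theorem toCyclic_add (x : ℤ) : toCyclic N (x + N) = antipode N (toCyclic N x) := by
  rw [← toCyclic_coe (antipode N _), toCyclic_eq_iff, antipode_val]
  have h := coe_toCyclic (N := N) x
  have h2 := Int.emod_add_mul_ediv x (2 * N)
  split_ifs with h3
  · exact ⟨x / (2 * N), by push_cast; linarith⟩
  · refine ⟨x / (2 * N) + 1, ?_⟩
    rw [Nat.cast_sub (by omega), h]
    linarith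

theorem IsAntipodalNoncrossing.apply_toCyclic {α : Type*} {c : ℤ → α}
    (hc : IsAntipodalNoncrossing (N : ℤ) c) (x : ℤ) : c (toCyclic N x).1 = c x := by
  rw [← hc.periodic_mul (x / (2 * N)), coe_toCyclic, Int.emod_add_mul_ediv]

end Cyclic

section Partitions

variable {N : ℕ}

theorem Finpartition.ext_of_part {M : ℕ} {P Q : Finpartition (Finset.univ : Finset (Fin M))}
    (h : ∀ i j, P.part i = P.part j ↔ Q.part i = Q.part j) : P = Q := by
  have hpart : ∀ i, P.part i = Q.part i := fun i => by
    ext j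
    rw [P.mem_part_iff_part_eq_part (Finset.mem_univ j) (Finset.mem_univ i),
      Q.mem_part_iff_part_eq_part (Finset.mem_univ j) (Finset.mem_univ i), h]
  have hparts : ∀ R : Finpartition (Finset.univ : Finset (Fin M)),
      R.parts = Finset.univ.image R.part := fun R => by
    ext B
    simp only [Finset.mem_image, Finset.mem_univ, true_and]
    constructor
    · intro hB
      obtain ⟨i, hi⟩ := R.nonempty_of_mem_parts hB
      exact ⟨i, R.part_eq_of_mem hB hi⟩
    · rintro ⟨i, rfl⟩
      exact R.part_mem.2 (Finset.mem_univ i)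
  ext1
  rw [hparts, hparts]
  congr 1
  exact funext hpart

theorem Finpartition.image_antipode_part {P : Finpartition (Finset.univ : Finset (Fin (2 * N)))}
    (hP : ∀ B ∈ P.parts, B.image (antipode N) ∈ P.parts) (i : Fin (2 * N)) :
    (P.part i).image (antipode N) = P.part (antipode N i) :=
  (P.part_eq_of_mem (hP _ (P.part_mem.2 (Finset.mem_univ i)))
    (Finset.mem_image_of_mem _ (P.mem_part_self.2 (Finset.mem_univ i)))).symm

theorem isNoncrossing_of_part_eq_iff {α : Type*} {c : ℤ → α}
    (hc : IsAntipodalNoncrossing (N : ℤ) c) {P : Finpartition (Finset.univ : Finset (Fin (2 * N)))}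
    (hP : ∀ i j, P.part i = P.part j ↔ c i.1 = c j.1) : IsNoncrossing P := by
  rintro ⟨i, j, k, l, B, B', hij, hjk, hkl, hB, hB', hne, hi, hk, hj, hl⟩
  have hl2 := l.2
  have e1 : c i.1 = c k.1 := by
    rw [← hP, P.part_eq_of_mem hB hi, P.part_eq_of_mem hB hk]
  have e2 : c j.1 = c l.1 := by
    rw [← hP, P.part_eq_of_mem hB' hj, P.part_eq_of_mem hB' hl]
  have := hc.noncrossing i.1 j.1 k.1 l.1 (by exact_mod_cast hij) (by exact_mod_cast hjk)
    (by exact_mod_cast hkl) (by omega) e1 e2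
  rw [← hP, P.part_eq_of_mem hB hi, P.part_eq_of_mem hB' hj] at this
  exact hne this

variable [NeZero N]

/-- The coloring of `ℤ` by the blocks of a partition of `ℤ / 2N`. -/
def liftColor (P : Finpartition (Finset.univ : Finset (Fin (2 * N)))) (x : ℤ) :
    Finset (Fin (2 * N)) := P.part (toCyclic N x)

theorem liftColor_noncrossing_of_nonneg {P : Finpartition (Finset.univ : Finset (Fin (2 * N)))}
    (hP : IsNoncrossing P) {x y z t : ℤ} (hx : 0 ≤ x) (hxy : x < y) (hyz : y < z) (hzt : z < t)
    (ht : t < 2 * N) (hxz : liftColor P x = liftColor P z) (hyt : liftColor P y = liftColor P t) :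
    liftColor P x = liftColor P y := by
  by_contra hne
  have hlt : ∀ {a b : ℤ}, 0 ≤ a → a < b → b < 2 * N → toCyclic N a < toCyclic N b := by
    intro a b h1 h2 h3
    rw [Fin.lt_def, ← Nat.cast_lt (α := ℤ), coe_toCyclic, coe_toCyclic,
      Int.emod_eq_of_lt h1 (by omega), Int.emod_eq_of_lt (by omega) h3]
    exact h2
  have hself : ∀ a, toCyclic N a ∈ liftColor P a := fun a => P.mem_part_self.2 (Finset.mem_univ _)
  exact hP ⟨_, _, _, _, liftColor P x, liftColor P y, hlt hx hxy (by omega),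
    hlt (by omega) hyz (by omega), hlt (by omega) hzt ht, P.part_mem.2 (Finset.mem_univ _),
    P.part_mem.2 (Finset.mem_univ _), hne, hself x, hxz ▸ hself z, hself y, hyt ▸ hself t⟩

theorem isAntipodalNoncrossing_liftColor {P : Finpartition (Finset.univ : Finset (Fin (2 * N)))}
    (hP : IsNoncrossing P) (hsymm : ∀ B ∈ P.parts, B.image (antipode N) ∈ P.parts) :
    IsAntipodalNoncrossing (N : ℤ) (liftColor P) := by
  have hper : ∀ m x : ℤ, liftColor P (x + 2 * N * m) = liftColor P x := fun m x => by
    unfold liftColor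
    rw [toCyclic_eq_iff.2]
    simp
  refine ⟨fun x => by simpa using hper 1 x, fun x y h => ?_, ?_⟩
  · unfold liftColor at h ⊢
    rw [toCyclic_add, toCyclic_add, ← Finpartition.image_antipode_part hsymm, h,
      Finpartition.image_antipode_part hsymm]
  · have hbase : ∀ x y z t : ℤ, 0 ≤ x → x < 2 * N → x < y → y < z → z < t → t < x + 2 * N →
        liftColor P x = liftColor P z → liftColor P y = liftColor P t →
        liftColor P x = liftColor P y := by
      intro x y z t hx hxN hxy hyz hzt htx hxz hyt
      have hp : ∀ a, liftColor P (a - 2 * N) = liftColor P a := fun a => by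
        have := hper (-1) a
        rwa [show a + 2 * N * (-1) = a - 2 * (N : ℤ) by ring] at this
      have hp1 := hp y
      have hp2 := hp z
      have hp3 := hp t
      by_cases ht : t < 2 * N
      · exact liftColor_noncrossing_of_nonneg hP hx hxy hyz hzt ht hxz hyt
      by_cases hz : z < 2 * N
      · have := liftColor_noncrossing_of_nonneg hP (x := t - 2 * N) (y := x) (z := y) (t := z)
          (by omega) (by omega) hxy hyz hz (by rw [hp3, hyt]) hxz
        rw [← this, hp3, hyt]
      by_cases hy : y < 2 * N
      · have := liftColor_noncrossing_of_nonneg hP (x := z - 2 * N) (y := t - 2 * N) (z := x)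
          (t := y) (by omega) (by omega) (by omega) hxy hy (by rw [hp2, hxz]) (by rw [hp3, hyt])
        rw [hxz, hyt, ← hp2, this, hp3]
      · have := liftColor_noncrossing_of_nonneg hP (x := y - 2 * N) (y := z - 2 * N)
          (z := t - 2 * N) (t := x) (by omega) (by omega) (by omega) (by omega) hxN
          (by rw [hp1, hp3, hyt]) (by rw [hp2, hxz])
        rw [hxz, ← hp1, this, hp2]
    intro x y z t hxy hyz hzt htx hxz hyt
    have hN := NeZero.pos N
    have h1 := Int.emod_nonneg x (show (2 * N : ℤ) ≠ 0 by omega)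
    have h2 := Int.emod_lt_of_pos x (show (0 : ℤ) < 2 * N by omega)
    have h3 := Int.emod_add_mul_ediv x (2 * N)
    have hs : ∀ a, liftColor P (a - 2 * N * (x / (2 * N))) = liftColor P a := fun a => by
      rw [← hper (x / (2 * N)) (a - _), sub_add_cancel]
    rw [← hs x, ← hs y]
    refine hbase _ _ (z - 2 * N * (x / (2 * N))) (t - 2 * N * (x / (2 * N))) ?_ ?_ ?_ ?_ ?_ ?_ ?_ ?_
    all_goals first | rw [hs, hs]; assumption | linarith

theorem card_part_of_isFirst {P : Finpartition (Finset.univ : Finset (Fin (2 * N)))}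
    (hc : IsAntipodalNoncrossing (N : ℤ) (liftColor P)) {i : Fin (2 * N)}
    (hi : IsFirst (N : ℤ) (liftColor P) i.1) :
    (P.part i).card = openingSize (N : ℤ) (liftColor P) i.1 := by
  have hN : (0 : ℤ) < N := by exact_mod_cast NeZero.pos N
  have hci : liftColor P i.1 = P.part i := by rw [liftColor, toCyclic_coe]
  unfold openingSize
  rw [if_pos hi]
  refine (Finset.card_bij (fun x _ => toCyclic N x) ?_ ?_ ?_).symm
  · intro x hx
    rw [mem_arcBlock] at hx
    rw [← hci, hx.2]
    exact P.mem_part_self.2 (Finset.mem_univ _)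
  · intro x hx y hy h
    rw [mem_arcBlock] at hx hy
    obtain ⟨m, hm⟩ := toCyclic_eq_iff.1 h
    have h3 : m < 1 := by by_contra! h; nlinarith
    have h4 : -1 < m := by by_contra! h; nlinarith
    obtain rfl : m = 0 := by omega
    linarith
  · intro b hb
    obtain ⟨y, hy1, hy2, hy, hd⟩ := hc.exists_shift hN i.1 b.1
    have hcb : liftColor P b.1 = liftColor P i.1 := by
      rw [hci, liftColor, toCyclic_coe]
      exact (P.mem_part_iff_part_eq_part (Finset.mem_univ _) (Finset.mem_univ _)).1 hb
    refine ⟨y, mem_arcBlock.2 ⟨⟨hy1, ?_⟩, by rw [hy, hcb]⟩, ?_⟩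
    · by_contra! h
      refine hi (y - 2 * N) (by omega) (by omega) ?_
      rw [← hc.periodic, sub_add_cancel, hy, hcb]
    · rw [← toCyclic_coe b, eq_comm, toCyclic_eq_iff]
      exact hd

theorem map_card_nonantipodal_parts {P : Finpartition (Finset.univ : Finset (Fin (2 * N)))}
    (hP : IsNoncrossing P) (hsymm : ∀ B ∈ P.parts, B.image (antipode N) ∈ P.parts) :
    (P.parts.filter fun B => B.image (antipode N) ≠ B).val.map Finset.card =
      nonzeroValues (fun i : Fin N => openingSize (N : ℤ) (liftColor P) i.1) +
        nonzeroValues (fun i : Fin N => openingSize (N : ℤ) (liftColor P) i.1) := by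
  classical
  have hN : (0 : ℤ) < N := by exact_mod_cast NeZero.pos N
  have hc := isAntipodalNoncrossing_liftColor hP hsymm
  have hcol : ∀ i : Fin (2 * N), liftColor P i.1 = P.part i := fun i => by
    rw [liftColor, toCyclic_coe]
  have hcolN : ∀ i : Fin (2 * N), liftColor P (i.1 + N) = (P.part i).image (antipode N) :=
    fun i => by rw [liftColor, toCyclic_add, toCyclic_coe, Finpartition.image_antipode_part hsymm]
  rw [← nonzeroValues_two_mul hc.openingSize_add]
  set F : Finset (Fin (2 * N)) :=
    Finset.univ.filter fun i => openingSize (N : ℤ) (liftColor P) i.1 ≠ 0 with hF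
  have hmemF : ∀ i, i ∈ F ↔ IsFirst (N : ℤ) (liftColor P) i.1 := fun i => by
    rw [hF, Finset.mem_filter, IsAntipodalNoncrossing.openingSize_ne_zero hN]
    simp
  have hinj : Set.InjOn P.part (F : Set (Fin (2 * N))) := by
    intro i hi j hj h
    rw [Finset.mem_coe, hmemF] at hi hj
    have := hc.dvd_of_isFirst hN hi hj (by rw [hcol, hcol, h])
    rw [← toCyclic_coe i, ← toCyclic_coe j, toCyclic_eq_iff]
    exact this
  have himage : (P.parts.filter fun B => B.image (antipode N) ≠ B) = F.image P.part := by
    ext B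
    simp only [Finset.mem_filter, Finset.mem_image]
    constructor
    · rintro ⟨hB, hne⟩
      obtain ⟨i, hi⟩ := P.nonempty_of_mem_parts hB
      obtain rfl := P.part_eq_of_mem hB hi
      rw [← hcolN, ← hcol] at hne
      obtain ⟨y, -, -, hy, hf⟩ := hc.exists_isFirst hN hne.symm
      refine ⟨toCyclic N y, (hmemF _).2 (hc.isFirst_of_dvd hf ?_), ?_⟩
      · rw [← toCyclic_eq_iff, toCyclic_coe]
      · rw [← hcol i, ← hy]; rfl
    · rintro ⟨i, hi, rfl⟩
      refine ⟨P.part_mem.2 (Finset.mem_univ _), ?_⟩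
      rw [← hcolN, ← hcol]
      exact (((hmemF i).1 hi).ne_add hc hN).symm
  rw [himage, Finset.image_val_of_injOn hinj, Multiset.map_map, nonzeroValues, Multiset.filter_map]
  refine Multiset.map_congr rfl fun i hi => ?_
  exact card_part_of_isFirst hc ((hmemF i).1 hi)

theorem image_antipode_mem_parts_of_part_eq_iff {α : Type*} {c : ℤ → α}
    (hc : IsAntipodalNoncrossing (N : ℤ) c) {P : Finpartition (Finset.univ : Finset (Fin (2 * N)))}
    (hP : ∀ i j, P.part i = P.part j ↔ c i.1 = c j.1) :
    ∀ B ∈ P.parts, B.image (antipode N) ∈ P.parts := by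
  intro B hB
  have hca : ∀ i : Fin (2 * N), c (antipode N i).1 = c (i.1 + N) := fun i => by
    rw [← hc.apply_toCyclic (i.1 + N), toCyclic_add, toCyclic_coe]
  have hmem : ∀ i j, i ∈ P.part j ↔ c i.1 = c j.1 := fun i j => by
    rw [← hP, P.mem_part_iff_part_eq_part (Finset.mem_univ _) (Finset.mem_univ _)]
  obtain ⟨i, hi⟩ := P.nonempty_of_mem_parts hB
  obtain rfl := P.part_eq_of_mem hB hi
  have : (P.part i).image (antipode N) = P.part (antipode N i) := by
    ext j
    rw [Finset.mem_image]
    constructor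
    · rintro ⟨a, ha, rfl⟩
      rw [hmem] at ha ⊢
      rw [hca, hca]
      exact hc.shift _ _ ha
    · intro hj
      refine ⟨antipode N j, ?_, antipode_antipode j⟩
      rw [hmem] at hj ⊢
      rw [hca, ← hc.shift_iff, add_assoc, ← two_mul, hc.periodic, hj, hca]
  rw [this]
  exact P.part_mem.2 (Finset.mem_univ _)

theorem exists_openingSize_liftColor_eq (w : Fin N → ℕ) (hw : ∑ i, w i ≤ N) :
    ∃ P : Finpartition (Finset.univ : Finset (Fin (2 * N))), IsNoncrossing P ∧
      (∀ B ∈ P.parts, B.image (antipode N) ∈ P.parts) ∧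
      ∀ i : Fin N, openingSize (N : ℤ) (liftColor P) i.1 = w i := by
  classical
  have hN : (0 : ℤ) < N := by exact_mod_cast NeZero.pos N
  have hlt : ∀ x : ℤ, (x % N).toNat < N := fun x => by
    have h1 := Int.emod_nonneg x hN.ne'
    have h2 := Int.emod_lt_of_pos x hN
    omega
  set W : ℤ → ℕ := fun x => w ⟨(x % N).toNat, hlt x⟩ with hWdef
  have hWi : ∀ i : Fin N, W i.1 = w i := fun i => by
    simp only [hWdef]
    congr 1
    ext
    simp [Nat.mod_eq_of_lt i.2, ← Int.natCast_mod]
  have hW : ∀ x, W (x + N) = W x := fun x => by simp [hWdef]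
  have hsum : ∑ t ∈ Finset.Ico (0 : ℤ) N, W t = ∑ i, w i := by
    refine (Finset.sum_bij (fun (i : Fin N) _ => (i.1 : ℤ)) ?_ ?_ ?_ ?_).symm
    · intro i _
      have := i.2
      exact Finset.mem_Ico.2 ⟨by omega, by omega⟩
    · intro i _ j _ h
      ext
      exact_mod_cast h
    · intro t ht
      rw [Finset.mem_Ico] at ht
      exact ⟨⟨t.toNat, by omega⟩, Finset.mem_univ _, by simp [ht.1]⟩
    · intro i _
      rw [hWi]
  have hle : height W N ≤ height W 0 := by
    rw [height_eq_add_sum W hN.le, ← Nat.cast_sum, hsum]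
    omega
  have hc := isAntipodalNoncrossing_ownerClass hN hW hle
  set P : Finpartition (Finset.univ : Finset (Fin (2 * N))) :=
    Finpartition.ofSetoid (Setoid.ker fun i : Fin (2 * N) => ownerClass W N i.1) with hPdef
  have hP : ∀ i j : Fin (2 * N),
      P.part i = P.part j ↔ ownerClass W N i.1 = ownerClass W N j.1 := fun i j => by
    rw [← P.mem_part_iff_part_eq_part (Finset.mem_univ _) (Finset.mem_univ _), hPdef,
      Finpartition.mem_part_ofSetoid_iff_rel, Setoid.ker_def, eq_comm]
  refine ⟨P, isNoncrossing_of_part_eq_iff hc hP, image_antipode_mem_parts_of_part_eq_iff hc hP,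
    fun i => ?_⟩
  rw [openingSize_congr (d := ownerClass W N), openingSize_ownerClass hN hW hle, hWi]
  intro x y
  rw [liftColor, liftColor, hP, hc.apply_toCyclic, hc.apply_toCyclic]

theorem eq_of_openingSize_liftColor_eq {P Q : Finpartition (Finset.univ : Finset (Fin (2 * N)))}
    (hP : IsAntipodalNoncrossing (N : ℤ) (liftColor P))
    (hQ : IsAntipodalNoncrossing (N : ℤ) (liftColor Q))
    (h : ∀ i : Fin N, openingSize (N : ℤ) (liftColor P) i.1 =
      openingSize (N : ℤ) (liftColor Q) i.1) : P = Q := by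
  have hN : (0 : ℤ) < N := by exact_mod_cast NeZero.pos N
  have hmod : ∀ {R : Finpartition (Finset.univ : Finset (Fin (2 * N)))},
      IsAntipodalNoncrossing (N : ℤ) (liftColor R) → ∀ x : ℤ,
      openingSize (N : ℤ) (liftColor R) x = openingSize (N : ℤ) (liftColor R) (x % N) := by
    intro R hR x
    have : Function.Periodic (openingSize (N : ℤ) (liftColor R)) N := hR.openingSize_add
    have h1 := this.int_mul (x / N) (x % N)
    rw [← h1]
    congr 1
    simp only [Int.cast_id]
    linarith [Int.emod_add_mul_ediv x N]
  have heq : openingSize (N : ℤ) (liftColor P) = openingSize (N : ℤ) (liftColor Q) := by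
    funext x
    have h1 := Int.emod_nonneg x hN.ne'
    have h2 := Int.emod_lt_of_pos x hN
    have := h ⟨(x % N).toNat, by omega⟩
    rw [Int.toNat_of_nonneg h1] at this
    rw [hmod hP, hmod hQ, this]
  refine Finpartition.ext_of_part fun i j => ?_
  rw [← toCyclic_coe i, ← toCyclic_coe j]
  exact (hP.eq_iff_ownerClass_eq hN).trans (heq ▸ (hQ.eq_iff_ownerClass_eq hN).symm)

theorem ncard_antipodal_noncrossing_eq (mu : Multiset ℕ) (hpos : ∀ i ∈ mu, 0 < i)
    (hsum : mu.sum ≤ N) :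
    {P : Finpartition (Finset.univ : Finset (Fin (2 * N))) | IsNoncrossing P ∧
      (∀ B ∈ P.parts, B.image (antipode N) ∈ P.parts) ∧
      (P.parts.filter fun B => B.image (antipode N) ≠ B).val.map Finset.card = mu + mu}.ncard =
      N.factorial / (mfac mu * (N - Multiset.card mu).factorial) := by
  have hcard : Multiset.card mu ≤ N := by
    refine le_trans ?_ hsum
    simpa using Multiset.card_nsmul_le_sum (s := mu) (a := 1) hpos
  have hdouble : ∀ s : Multiset ℕ, s + s = mu + mu ↔ s = mu := fun s => by
    rw [← two_nsmul, ← two_nsmul]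
    exact ⟨fun h => Multiset.ext.2 fun a => by
      have := congrArg (Multiset.count a) h
      simpa using this, fun h => by rw [h]⟩
  rw [← ncard_nonzeroValues_eq N mu hpos hcard]
  refine Set.ncard_congr (fun P _ i => openingSize (N : ℤ) (liftColor P) i.1) ?_ ?_ ?_
  · rintro P ⟨h1, h2, h3⟩
    rwa [map_card_nonantipodal_parts h1 h2, hdouble] at h3
  · rintro P Q ⟨h1, h2, -⟩ ⟨h4, h5, -⟩ h
    exact eq_of_openingSize_liftColor_eq (isAntipodalNoncrossing_liftColor h1 h2)
      (isAntipodalNoncrossing_liftColor h4 h5) (congrFun h)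
  · rintro w hw
    have hwsum : ∑ i, w i = mu.sum := by
      rw [← (show nonzeroValues w = mu from hw), nonzeroValues, Finset.sum]
      conv_lhs => rw [← Multiset.filter_add_not (· ≠ 0) (Finset.univ.val.map w), Multiset.sum_add]
      rw [Nat.add_eq_left, Multiset.sum_eq_zero]
      intro x hx
      simpa using (Multiset.mem_filter.1 hx).2
    obtain ⟨P, h1, h2, h3⟩ := exists_openingSize_liftColor_eq w (hwsum ▸ hsum)
    refine ⟨P, ⟨h1, h2, ?_⟩, funext h3⟩
    rw [map_card_nonantipodal_parts h1 h2, funext h3, hdouble]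
    exact hw

theorem card_antipodal_part {P : Finpartition (Finset.univ : Finset (Fin (2 * N)))}
    (hP : IsNoncrossing P) (hsymm : ∀ B ∈ P.parts, B.image (antipode N) ∈ P.parts)
    {B : Finset (Fin (2 * N))} (hB : B ∈ P.parts) (hBB : B.image (antipode N) = B) :
    ((P.parts.filter fun B => B.image (antipode N) ≠ B).val.map Finset.card).sum + B.card =
      2 * N := by
  have hN : (0 : ℤ) < N := by exact_mod_cast NeZero.pos N
  have hc := isAntipodalNoncrossing_liftColor hP hsymm
  have hcol : ∀ {B}, B ∈ P.parts → B.image (antipode N) = B → ∃ x : ℤ,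
      liftColor P x = B ∧ liftColor P x = liftColor P (x + N) := fun {B} hB hBB => by
    obtain ⟨i, hi⟩ := P.nonempty_of_mem_parts hB
    obtain rfl := P.part_eq_of_mem hB hi
    refine ⟨i.1, by rw [liftColor, toCyclic_coe], ?_⟩
    rw [liftColor, liftColor, toCyclic_add, toCyclic_coe,
      ← Finpartition.image_antipode_part hsymm, hBB]
  have hfilter : (P.parts.filter fun B => ¬ B.image (antipode N) ≠ B) = {B} := by
    ext C
    simp only [Finset.mem_filter, ne_eq, not_not, Finset.mem_singleton]
    constructor
    · rintro ⟨hC, hCC⟩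
      obtain ⟨x, hx, hx'⟩ := hcol hB hBB
      obtain ⟨y, hy, hy'⟩ := hcol hC hCC
      rw [← hx, ← hy, hc.eq_of_antipodal hN hx' hy']
    · rintro rfl
      exact ⟨hB, hBB⟩
  have hs := P.sum_card_parts
  rw [← Finset.sum_filter_add_sum_filter_not P.parts fun B => B.image (antipode N) ≠ B, hfilter,
    Finset.sum_singleton, Finset.card_univ, Fintype.card_fin] at hs
  exact hs

end Partitions

theorem mfac_map_mul {k : ℕ} (hk : 0 < k) (lam : Multiset ℕ) :
    mfac (lam.map (k * ·)) = mfac lam := by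
  have hinj : Function.Injective (k * · : ℕ → ℕ) := fun a b h => Nat.eq_of_mul_eq_mul_left hk h
  unfold mfac
  rw [Multiset.toFinset_map, Finset.prod_image hinj.injOn]
  exact Finset.prod_congr rfl fun i _ => by rw [Multiset.count_map_eq_count' _ _ hinj]

/-- The number of `k`-divisible type B noncrossing partitions of `{±1, …, ±kn}` with type
`λ` (one block from each antipodal orbit of size two, sizes divided by `k`; equivalently
the multiset of non-antipodal block sizes over `k` is `λ + λ`) is
`(kn)! / (m_λ·(kn-ℓ(λ))!)`. -/
theorem stmt_15 (k n : ℕ) (hk : 0 < k) (lam : Multiset ℕ) (hsum : lam.sum ≤ n)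
    (hpos : ∀ i ∈ lam, 0 < i) :
    {P : Finpartition (Finset.univ : Finset (Fin (2 * (k * n)))) |
        IsNoncrossing P ∧ (∀ B ∈ P.parts, B.image (antipode (k * n)) ∈ P.parts) ∧
          (∀ B ∈ P.parts, k ∣ B.card) ∧
          (P.parts.filter fun B => B.image (antipode (k * n)) ≠ B).val.map
              (fun B => B.card / k) = lam + lam}.ncard =
      (k * n).factorial / (mfac lam * (k * n - Multiset.card lam).factorial) := by
  rcases Nat.eq_zero_or_pos n with rfl | hn
  · have hlam : lam = 0 := by
      refine Multiset.eq_zero_of_forall_notMem fun i hi => ?_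
      have := hpos i hi
      have := Multiset.le_sum_of_mem hi
      omega
    subst hlam
    have hparts : ∀ P : Finpartition (Finset.univ : Finset (Fin (2 * (k * 0)))), P.parts = ∅ := by
      intro P
      refine Finset.eq_empty_of_forall_notMem fun B hB => ?_
      obtain ⟨i, -⟩ := P.nonempty_of_mem_parts hB
      exact absurd i.2 (by simp)
    have : (1 : ℕ) = (k * 0).factorial /
        (mfac 0 * (k * 0 - Multiset.card (0 : Multiset ℕ)).factorial) := by
      simp [mfac]
    rw [← this, Set.ncard_eq_one]
    refine ⟨⊥, Set.eq_singleton_iff_unique_mem.2 ⟨?_, fun P _ => ?_⟩⟩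
    · simp [IsNoncrossing, hparts]
    · ext1
      rw [hparts, hparts]
  · have : NeZero (k * n) := ⟨(Nat.mul_pos hk hn).ne'⟩
    have hmusum : (lam.map (k * ·)).sum = k * lam.sum := Multiset.sum_map_mul_left.trans (by simp)
    have key := ncard_antipodal_noncrossing_eq (N := k * n) (lam.map (k * ·))
      (fun i hi => by
        obtain ⟨j, hj, rfl⟩ := Multiset.mem_map.1 hi
        exact Nat.mul_pos hk (hpos j hj))
      (by rw [hmusum]; exact Nat.mul_le_mul_left k hsum)
    rw [mfac_map_mul hk, Multiset.card_map] at key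
    rw [← key]
    congr 1
    ext P
    refine and_congr_right fun hP => and_congr_right fun hsymm => ⟨?_, fun h => ?_⟩
    · rintro ⟨hdvd, h⟩
      rw [← Multiset.map_add, ← h, Multiset.map_map]
      refine Multiset.map_congr rfl fun B hB => ?_
      exact (Nat.mul_div_cancel' (hdvd B (Finset.mem_filter.1 hB).1)).symm
    · constructor
      · intro B hB
        by_cases hBB : B.image (antipode (k * n)) = B
        · have := card_antipodal_part hP hsymm hB hBB
          rw [h, Multiset.sum_add, hmusum] at this
          have h1 : k ∣ k * lam.sum + k * lam.sum := ⟨lam.sum + lam.sum, by ring⟩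
          exact (Nat.dvd_add_right h1).1 ⟨2 * n, by rw [this]; ring⟩
        · have : B.card ∈ lam.map (k * ·) + lam.map (k * ·) := by
            rw [← h]
            exact Multiset.mem_map_of_mem _ (Finset.mem_filter.2 ⟨hB, hBB⟩)
          rw [Multiset.mem_add, or_self, Multiset.mem_map] at this
          obtain ⟨j, -, hj⟩ := this
          exact ⟨j, hj.symm⟩
      · have := congrArg (Multiset.map (· / k)) h
        rw [Multiset.map_map, Multiset.map_add, Multiset.map_map] at this
        simpa [Function.comp_def, Nat.mul_div_cancel_left _ hk] using this
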